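/- (Probability form of the Finner inequality.) Let ι be a finite set of sources and J a finite set of parties with neighborhoods N_j ⊆ ι; let each source i carry a finite set X_i and probability weights μ_i summing to 1, sources independent. Let x_j ∈ (0,1] be a fractional independent set (for every i, ∑_{j : i∈N_j} x_j ≤ 1). For each party j let g_j be a function of the coordinates (s_i)_{i∈N_j} with values in a finite output set O_j, and fix outputs α_j ∈ O_j. Then P[g_j(s) = α_j for all j ∈ J] ≤ ∏_{j∈J} P[g_j(s) = α_j]^{x_j}. -/

import Mathlib

open Finset Function

/-- Weighted AM-GM inequality for weights of total mass at most one. -/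
lemma prod_rpow_le_one_add_sum_mul_sub_one {J : Type*} [Fintype J] (y h : J → ℝ)
    (hy0 : ∀ j, 0 ≤ y j) (hy1 : ∑ j, y j ≤ 1) (hh : ∀ j, 0 ≤ h j) :
    ∏ j, h j ^ y j ≤ 1 + ∑ j, y j * (h j - 1) := by
  have key := Real.geom_mean_le_arith_mean_weighted (univ : Finset (Option J))
    (fun o => o.elim (1 - ∑ j, y j) y) (fun o => o.elim 1 h)
    (by rintro (_ | j) _ <;> simp [hy0, hy1]) (by simp [Fintype.sum_option])
    (by rintro (_ | j) _ <;> simp [hh])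
  simp only [Fintype.prod_option, Fintype.sum_option, Option.elim_none, Option.elim_some,
    Real.one_rpow, one_mul, mul_one] at key
  simp only [mul_sub, mul_one, sum_sub_distrib]
  linarith

/-- Generalized Hölder inequality on a finite probability space, where the exponents of the
non-constant functions sum to at most one. -/
lemma sum_mul_prod_rpow_le {J T : Type*} [Fintype J] [Fintype T]
    (p : J → Prop) [DecidablePred p] (x : J → ℝ) (hx : ∀ j, 0 < x j)
    (hp : ∑ j ∈ univ.filter p, x j ≤ 1) (ν : T → ℝ) (hν0 : ∀ t, 0 ≤ ν t) (hν1 : ∑ t, ν t = 1)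
    (f : J → T → ℝ) (hf : ∀ j t, 0 ≤ f j t) (hconst : ∀ j, ¬ p j → ∀ t t', f j t = f j t') :
    ∑ t, ν t * ∏ j, f j t ^ x j ≤ ∏ j, (∑ t, ν t * f j t) ^ x j := by
  have hF0 : ∀ j, 0 ≤ ∑ t, ν t * f j t := fun j =>
    sum_nonneg fun t _ => mul_nonneg (hν0 t) (hf j t)
  by_cases hzero : ∃ j, ∑ t, ν t * f j t = 0
  · obtain ⟨j, hj⟩ := hzero
    rw [sum_eq_zero_iff_of_nonneg fun t _ => mul_nonneg (hν0 t) (hf j t)] at hj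
    rw [sum_eq_zero fun t _ => ?_]
    · exact prod_nonneg fun j _ => Real.rpow_nonneg (hF0 j) _
    · rcases mul_eq_zero.mp (hj t (mem_univ t)) with h | h
      · rw [h, zero_mul]
      · rw [prod_eq_zero (mem_univ j) (by rw [h, Real.zero_rpow (hx j).ne']), mul_zero]
  push Not at hzero
  set F : J → ℝ := fun j => ∑ t, ν t * f j t with hF
  have hFpos : ∀ j, 0 < F j := fun j => lt_of_le_of_ne (hF0 j) (Ne.symm (hzero j))
  have hFconst : ∀ j, ¬ p j → ∀ t, f j t = F j := fun j hj t => by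
    simp only [hF, fun t' => hconst j hj t' t, ← sum_mul, hν1, one_mul]
  have hpt : ∀ t, ∏ j, f j t ^ x j ≤
      (∏ j, F j ^ x j) * (1 + ∑ j, (if p j then x j else 0) * (f j t / F j - 1)) := fun t => by
    have h := prod_rpow_le_one_add_sum_mul_sub_one (fun j => if p j then x j else 0)
      (fun j => f j t / F j) (fun j => by split_ifs <;> simp [(hx j).le])
      (by rwa [← sum_filter]) (fun j => div_nonneg (hf j t) (hFpos j).le)
    refine le_of_eq_of_le ?_ (mul_le_mul_of_nonneg_left h
      (prod_nonneg fun j _ => Real.rpow_nonneg (hFpos j).le (x j)))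
    rw [← prod_mul_distrib]
    refine prod_congr rfl fun j _ => ?_
    split_ifs with hj
    · rw [← Real.mul_rpow (hFpos j).le (div_nonneg (hf j t) (hFpos j).le),
        mul_div_cancel₀ _ (hFpos j).ne']
    · rw [Real.rpow_zero, mul_one, hFconst j hj t]
  have hmean : ∀ j, ∑ t, ν t * (f j t / F j - 1) = 0 := fun j => by
    have h : ∀ t, ν t * (f j t / F j - 1) = ν t * f j t / F j - ν t := fun t => by ring
    simp only [h, sum_sub_distrib, ← sum_div, hν1]
    exact sub_eq_zero.mpr (div_self (hFpos j).ne')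
  calc ∑ t, ν t * ∏ j, f j t ^ x j
      ≤ ∑ t, ν t * ((∏ j, F j ^ x j) *
          (1 + ∑ j, (if p j then x j else 0) * (f j t / F j - 1))) :=
        sum_le_sum fun t _ => mul_le_mul_of_nonneg_left (hpt t) (hν0 t)
    _ = (∏ j, F j ^ x j) * (∑ t, ν t +
          ∑ j, (if p j then x j else 0) * ∑ t, ν t * (f j t / F j - 1)) := by
        simp only [mul_sum (univ : Finset T)]
        rw [sum_comm, ← sum_add_distrib, mul_sum]
        refine sum_congr rfl fun t _ => ?_
        rw [mul_left_comm, mul_add, mul_one, mul_sum]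
        simp only [mul_left_comm]
    _ = ∏ j, F j ^ x j := by simp [hmean, hν1]

section ProductExpectation

variable {ι : Type*} [Fintype ι] [DecidableEq ι] {X : ι → Type*} [∀ i, Fintype (X i)]

/-- Averaging over one coordinate preserves the expectation under a product distribution. -/
lemma sum_prod_mul_sum_update (μ : ∀ i, X i → ℝ) (hμ1 : ∀ i, ∑ t, μ i t = 1) (i : ι)
    (f : (∀ i, X i) → ℝ) :
    ∑ s : ∀ i, X i, (∏ k, μ k (s k)) * ∑ t, μ i t * f (update s i t) =
      ∑ s : ∀ i, X i, (∏ k, μ k (s k)) * f s := by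
  have hw : ∀ (s : ∀ i, X i) t,
      (∏ k, μ k (s k)) * μ i t = (∏ k, μ k (update s i t k)) * μ i (s i) := fun s t => by
    have hcompl : ∏ k ∈ {i}ᶜ, μ k (update s i t k) = ∏ k ∈ {i}ᶜ, μ k (s k) :=
      prod_congr rfl fun k hk => by rw [update_of_ne (by simpa using hk)]
    rw [Fintype.prod_eq_mul_prod_compl i, Fintype.prod_eq_mul_prod_compl i, update_self, hcompl]
    ring
  let e : (∀ i, X i) × X i → (∀ i, X i) × X i := fun q => (update q.1 i q.2, q.1 i)
  have he : Involutive e := fun q => by simp [e]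
  calc ∑ s : ∀ i, X i, (∏ k, μ k (s k)) * ∑ t, μ i t * f (update s i t)
      = ∑ q : (∀ i, X i) × X i, (∏ k, μ k ((e q).1 k)) * μ i (e q).2 * f (e q).1 := by
        simp only [e, ← hw, Fintype.sum_prod_type, mul_sum, mul_assoc]
    _ = ∑ q : (∀ i, X i) × X i, (∏ k, μ k (q.1 k)) * μ i q.2 * f q.1 :=
        Equiv.sum_comp he.toPerm fun q => (∏ k, μ k (q.1 k)) * μ i q.2 * f q.1
    _ = ∑ s : ∀ i, X i, (∏ k, μ k (s k)) * f s := by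
        simp only [Fintype.sum_prod_type, ← sum_mul, ← mul_sum, hμ1, mul_one]

/-- Finner's inequality for nonnegative functions `f j` depending only on the coordinates in
`N j ∩ S`. -/
lemma finner_inequality_inter {J : Type*} [Fintype J] (N : J → Finset ι) (x : J → ℝ)
    (hx : ∀ j, 0 < x j)
    (hfrac : ∀ i, ∑ j ∈ univ.filter (fun j => i ∈ N j), x j ≤ 1)
    (μ : ∀ i, X i → ℝ) (hμ0 : ∀ i t, 0 ≤ μ i t) (hμ1 : ∀ i, ∑ t, μ i t = 1)
    (S : Finset ι) (f : J → (∀ i, X i) → ℝ) (hf : ∀ j s, 0 ≤ f j s)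
    (hloc : ∀ j, ∀ s s' : ∀ i, X i, (∀ i ∈ N j ∩ S, s i = s' i) → f j s = f j s') :
    ∑ s : ∀ i, X i, (∏ i, μ i (s i)) * ∏ j, f j s ^ x j ≤
      ∏ j, (∑ s : ∀ i, X i, (∏ i, μ i (s i)) * f j s) ^ x j := by
  have hw0 : ∀ s : ∀ i, X i, 0 ≤ ∏ i, μ i (s i) := fun s => prod_nonneg fun i _ => hμ0 i _
  induction S using Finset.induction_on generalizing f with
  | empty =>
    have hw1 : ∑ s : ∀ i, X i, ∏ i, μ i (s i) = 1 := by
      rw [← Fintype.prod_sum]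
      simp [hμ1]
    exact sum_mul_prod_rpow_le (fun _ => False) x hx (by simp) _ hw0 hw1 f hf
      fun j _ s s' => hloc j s s' (by simp)
  | insert i S _ ih =>
    calc ∑ s : ∀ i, X i, (∏ i, μ i (s i)) * ∏ j, f j s ^ x j
        = ∑ s : ∀ i, X i, (∏ i, μ i (s i)) * ∑ t, μ i t * ∏ j, f j (update s i t) ^ x j :=
          (sum_prod_mul_sum_update μ hμ1 i fun s => ∏ j, f j s ^ x j).symm
      _ ≤ ∑ s : ∀ i, X i, (∏ i, μ i (s i)) * ∏ j, (∑ t, μ i t * f j (update s i t)) ^ x j := by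
          refine sum_le_sum fun s _ => mul_le_mul_of_nonneg_left ?_ (hw0 s)
          refine sum_mul_prod_rpow_le (fun j => i ∈ N j) x hx (hfrac i) (μ i) (hμ0 i) (hμ1 i)
            (fun j t => f j (update s i t)) (fun j t => hf j _) fun j hj t t' => ?_
          refine hloc j _ _ fun k hk => ?_
          have hki : k ≠ i := fun h => hj (h ▸ (mem_inter.mp hk).1)
          rw [update_of_ne hki, update_of_ne hki]
      _ ≤ ∏ j, (∑ s : ∀ i, X i, (∏ i, μ i (s i)) * ∑ t, μ i t * f j (update s i t)) ^ x j := by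
          refine ih (fun j s => ∑ t, μ i t * f j (update s i t))
            (fun j s => sum_nonneg fun t _ => mul_nonneg (hμ0 i t) (hf j _)) ?_
          refine fun j s s' h => sum_congr rfl fun t _ => congrArg (μ i t * ·) ?_
          refine hloc j _ _ fun k hk => ?_
          by_cases hki : k = i
          · subst hki
            simp
          · rw [update_of_ne hki, update_of_ne hki]
            exact h k (by simpa [hki] using hk)
      _ = ∏ j, (∑ s : ∀ i, X i, (∏ i, μ i (s i)) * f j s) ^ x j := by
          simp only [sum_prod_mul_sum_update μ hμ1]

end ProductExpectation

/-- Probability form of the Finner inequality: for independent sources, a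
fractional independent set `x j`, local response functions `g j` with values in
finite output sets, and fixed outputs `α j`, one has
`P[∀ j, g j (s) = α j] ≤ ∏ j P[g j (s) = α j]^(x j)`. -/
theorem finner_probability_form {ι J : Type} [Fintype ι] [DecidableEq ι] [Fintype J]
    {X : ι → Type} [∀ i, Fintype (X i)] [∀ i, Nonempty (X i)]
    {O : J → Type} [∀ j, Fintype (O j)] [∀ j, DecidableEq (O j)]
    (N : J → Finset ι)
    (x : J → ℝ) (hx : ∀ j, 0 < x j ∧ x j ≤ 1)
    (hfrac : ∀ i, ∑ j ∈ Finset.univ.filter (fun j => i ∈ N j), x j ≤ 1)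
    (μ : ∀ i, X i → ℝ) (hμ0 : ∀ i x, 0 ≤ μ i x) (hμ1 : ∀ i, ∑ x, μ i x = 1)
    (g : (j : J) → (∀ i, X i) → O j)
    (hloc : ∀ j, ∀ s s' : ∀ i, X i, (∀ i ∈ N j, s i = s' i) → g j s = g j s')
    (α : (j : J) → O j) :
    ∑ s : ∀ i, X i, (∏ i, μ i (s i)) * (if ∀ j, g j s = α j then (1 : ℝ) else 0)
      ≤ ∏ j, (∑ s : ∀ i, X i, (∏ i, μ i (s i)) * (if g j s = α j then (1 : ℝ) else 0)) ^ (x j) := by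
  have hind : ∀ s : ∀ i, X i, (if ∀ j, g j s = α j then (1 : ℝ) else 0) =
      ∏ j, (if g j s = α j then (1 : ℝ) else 0) ^ x j := fun s => by
    split_ifs with h
    · simp [h]
    · push Not at h
      obtain ⟨j, hj⟩ := h
      exact (prod_eq_zero (mem_univ j) (by rw [if_neg hj, Real.zero_rpow (hx j).1.ne'])).symm
  simp only [hind]
  refine finner_inequality_inter N x (fun j => (hx j).1) hfrac μ hμ0 hμ1 univ
    (fun j s => if g j s = α j then (1 : ℝ) else 0)
    (fun j s => by split_ifs <;> norm_num) fun j s s' h => ?_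
  simp only [hloc j s s' fun i hi => h i (by simpa using hi)]
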